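/- (Corollary: Poisson cohomology of R, Monnier's theorem.) For every k with 0 ≤ k ≤ n, there is an isomorphism of ℂ-vector spaces HP^k(R) ≅ ⊕_{|β|=n−k, α+β∈C} ℂ·X^α dX^β, the direct sum being over β ∈ {0,1}^n with |β| = n−k and α ∈ ℕ^n with α + β ∈ C. -/

import Mathlib

open MvPolynomial

noncomputable section

abbrev Rp (n : ℕ) := MvPolynomial (Fin n) ℂ

/-- Ambient space of `k`-cochains: arbitrary functions `R^k → R`. -/
abbrev W (n k : ℕ) := (Fin k → Rp n) → Rp n

/-- `m ↦ {g, m}`, the Poisson bracket with `g` on the left, as a ℂ-linear map. -/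
def pbL {n : ℕ} (a : Fin n → Fin n → ℤ) (g : Rp n) : Rp n →ₗ[ℂ] Rp n :=
  ∑ j : Fin n, (LinearMap.mulLeft ℂ
      (∑ i : Fin n, C ((a i j : ℂ)) * X i * X j * pderiv i g)).comp
    (pderiv j).toLinearMap

def cmpl {k : ℕ} (i j : Fin (k + 1)) (m : ℕ) : Fin (k + 1) :=
  (((List.finRange (k + 1)).filter (fun x : Fin (k + 1) => decide (x ≠ i ∧ x ≠ j)))).getD m i

/-- The Poisson coboundary `δ_k`, as a ℂ-linear map on the ambient cochain spaces:
`δP(f_0,…,f_k) = ∑ (−1)^i {f_i, P(…omit f_i…)} + ∑_{i<j} (−1)^{i+j} P({f_i,f_j},…omit f_i,f_j…)`. -/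
def dltL {n : ℕ} (a : Fin n → Fin n → ℤ) (k : ℕ) : W n k →ₗ[ℂ] W n (k + 1) :=
  LinearMap.pi fun f : Fin (k + 1) → Rp n =>
    (∑ i : Fin (k + 1), (-1 : ℂ) ^ (i : ℕ) •
        ((pbL a (f i)).comp (LinearMap.proj (f ∘ i.succAbove))))
    + ∑ i : Fin (k + 1), ∑ j : Fin (k + 1),
        if i < j then
          (-1 : ℂ) ^ ((i : ℕ) + (j : ℕ)) •
            (LinearMap.proj (fun l : Fin k =>
              if (l : ℕ) = 0 then
                ∑ s : Fin n, ∑ t : Fin n,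
                  C ((a s t : ℂ)) * X s * X t * pderiv s (f i) * pderiv t (f j)
              else f (cmpl i j ((l : ℕ) - 1))) : W n k →ₗ[ℂ] Rp n)
        else 0

/-- `χ^k(R)`, the `R`-module of skew-symmetric multiderivations, as a ℂ-submodule of
the ambient space of cochains. -/
def chiSub (n : ℕ) (k : ℕ) : Submodule ℂ (W n k) where
  carrier := {P |
    (∀ (v : Fin k → Rp n) (i : Fin k) (x y : Rp n),
        P (Function.update v i (x + y))
          = P (Function.update v i x) + P (Function.update v i y)) ∧
    (∀ (v : Fin k → Rp n) (i : Fin k) (c : ℂ) (x : Rp n),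
        P (Function.update v i (c • x)) = c • P (Function.update v i x)) ∧
    (∀ (v : Fin k → Rp n) (g : Equiv.Perm (Fin k)),
        P (v ∘ g) = ((Equiv.Perm.sign g : ℤ) : ℂ) • P v) ∧
    (∀ (v : Fin k → Rp n) (i : Fin k) (x y : Rp n),
        P (Function.update v i (x * y))
          = x * P (Function.update v i y) + y * P (Function.update v i x))}
  add_mem' := by
    rintro P Q ⟨hP1, hP2, hP3, hP4⟩ ⟨hQ1, hQ2, hQ3, hQ4⟩
    refine ⟨?_, ?_, ?_, ?_⟩
    · intro v i x y; simp only [Pi.add_apply, hP1, hQ1]; ring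
    · intro v i c x; simp only [Pi.add_apply, hP2, hQ2, smul_add]
    · intro v g; simp only [Pi.add_apply, hP3, hQ3, smul_add]
    · intro v i x y; simp only [Pi.add_apply, hP4, hQ4]; ring
  zero_mem' := by
    refine ⟨?_, ?_, ?_, ?_⟩ <;> intros <;> simp
  smul_mem' := by
    rintro c P ⟨hP1, hP2, hP3, hP4⟩
    refine ⟨?_, ?_, ?_, ?_⟩
    · intro v i x y; simp only [Pi.smul_apply, hP1, smul_add]
    · intro v i c' x; simp only [Pi.smul_apply, hP2]; rw [smul_comm]
    · intro v g; simp only [Pi.smul_apply, hP3]; rw [smul_comm]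
    · intro v i x y; simp only [Pi.smul_apply, hP4, smul_add, mul_smul_comm]

/-- The coboundaries `im δ_{k-1} ⊆ χ^k` (zero for `k = 0`). -/
def Bcoh (n : ℕ) (a : Fin n → Fin n → ℤ) : (k : ℕ) → Submodule ℂ (W n k)
  | 0 => ⊥
  | (k + 1) => Submodule.map (dltL a k) (chiSub n k)

/-- The cocycles `ker δ_k ⊆ χ^k`. -/
def Zcoh (n : ℕ) (a : Fin n → Fin n → ℤ) (k : ℕ) : Submodule ℂ (W n k) :=
  chiSub n k ⊓ LinearMap.ker (dltL a k)

/-- The Poisson cohomology `HP^k(R) = ker δ_k / im δ_{k-1}`. -/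
abbrev HPcoh (n : ℕ) (a : Fin n → Fin n → ℤ) (k : ℕ) : Type :=
  Zcoh n a k ⧸ (Bcoh n a k).comap (Zcoh n a k).subtype


/-- Membership in `C = {γ ∈ ℕ^n : ∀ i, γ_i = 0 or ∑_j a_{ij}(γ_j − 1) = 0}`. -/
def CsetPred {n : ℕ} (a : Fin n → Fin n → ℤ) (γ : Fin n → ℕ) : Prop :=
  ∀ i, γ i = 0 ∨ ∑ j : Fin n, a i j * ((γ j : ℤ) - 1) = 0

/-- The index set of the abstract right-hand side: pairs `(α, β)` with
`β ∈ {0,1}^n`, `|β| = n − k`, and `α + β ∈ C`. -/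
def IdxC (n : ℕ) (a : Fin n → Fin n → ℤ) (k : ℕ) : Type :=
  {p : (Fin n → ℕ) × Finset (Fin n) //
    p.2.card = n - k ∧ CsetPred a (fun i => p.1 i + if i ∈ p.2 then 1 else 0)}

/-! ### Coefficients with integer exponents -/

/-- The coefficient of `X ^ ν` for an integer exponent `ν`; it vanishes unless `0 ≤ ν`. -/
def coeffInt {n : ℕ} (ν : Fin n → ℤ) : Rp n →ₗ[ℂ] ℂ :=
  if ∀ i, 0 ≤ ν i then lcoeff ℂ (Finsupp.equivFunOnFinite.symm fun i => (ν i).toNat) else 0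

lemma coeffInt_natCast {n : ℕ} (μ : Fin n →₀ ℕ) (p : Rp n) :
    coeffInt (fun i => (μ i : ℤ)) p = coeff μ p := by
  have h : ∀ i, 0 ≤ ((μ i : ℕ) : ℤ) := fun i => Int.natCast_nonneg _
  rw [coeffInt, if_pos h]
  simp only [Int.toNat_natCast, lcoeff_apply]
  congr 1
  ext i
  simp

lemma coeffInt_of_neg {n : ℕ} {ν : Fin n → ℤ} {i : Fin n} (h : ν i < 0) (p : Rp n) :
    coeffInt ν p = 0 := by
  rw [coeffInt, if_neg (fun h' => absurd (h' i) (not_le.2 h)), LinearMap.zero_apply]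

lemma exists_natCast_or_exists_neg {n : ℕ} (ν : Fin n → ℤ) :
    (∃ μ : Fin n →₀ ℕ, ν = fun i => (μ i : ℤ)) ∨ ∃ i, ν i < 0 := by
  by_cases h : ∃ i, ν i < 0
  · exact Or.inr h
  · push Not at h
    refine Or.inl ⟨Finsupp.equivFunOnFinite.symm fun i => (ν i).toNat, funext fun i => ?_⟩
    simp [h i]

lemma nonneg_of_coeffInt_ne_zero {n : ℕ} {ν : Fin n → ℤ} {p : Rp n} (h : coeffInt ν p ≠ 0)
    (i : Fin n) : 0 ≤ ν i := by
  by_contra h'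
  exact h (coeffInt_of_neg (not_le.1 h') p)

lemma eq_of_coeffInt_eq {n : ℕ} {p q : Rp n} (h : ∀ ν, coeffInt ν p = coeffInt ν q) : p = q := by
  ext μ
  rw [← coeffInt_natCast, ← coeffInt_natCast, h]

lemma coeffInt_X_mul {n : ℕ} (ν : Fin n → ℤ) (i : Fin n) (p : Rp n) :
    coeffInt ν (X i * p) = coeffInt (ν - Pi.single i 1) p := by
  rcases exists_natCast_or_exists_neg ν with ⟨μ, rfl⟩ | ⟨j, hj⟩
  · rw [coeffInt_natCast, coeff_X_mul']
    split_ifs with hi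
    · rw [← coeffInt_natCast]
      congr 2
      funext j
      rcases eq_or_ne j i with rfl | hji
      · have := Finsupp.mem_support_iff.1 hi
        simp
        omega
      · simp [hji]
    · symm
      apply coeffInt_of_neg (i := i)
      simp [Finsupp.notMem_support_iff.1 hi]
  · rw [coeffInt_of_neg hj, coeffInt_of_neg (i := j)]
    rcases eq_or_ne j i with rfl | hji
    · simp; omega
    · simpa [hji] using hj

lemma coeffInt_X_mul_pderiv {n : ℕ} (ν : Fin n → ℤ) (j : Fin n) (p : Rp n) :
    coeffInt ν (X j * pderiv j p) = (ν j : ℂ) * coeffInt ν p := by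
  rcases exists_natCast_or_exists_neg ν with ⟨μ, rfl⟩ | ⟨i, hi⟩
  · rw [coeffInt_natCast, coeffInt_natCast]
    induction p using MvPolynomial.induction_on' with
    | monomial m r =>
      rw [X_mul_pderiv_monomial, coeff_smul, coeff_monomial]
      split_ifs with h
      · subst h; simp
      · simp
    | add p q hp hq => rw [map_add, mul_add, coeff_add, hp, hq, coeff_add, mul_add]
  · rw [coeffInt_of_neg hi, coeffInt_of_neg hi, mul_zero]

lemma exists_coeff_eq {n : ℕ} (f : (Fin n →₀ ℕ) → ℂ) (hf : (Function.support f).Finite) :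
    ∃ p : Rp n, ∀ μ, coeff μ p = f μ := by
  refine ⟨∑ μ ∈ hf.toFinset, monomial μ (f μ), fun μ => ?_⟩
  simp only [coeff_sum, coeff_monomial, Finset.sum_ite_eq', Set.Finite.mem_toFinset]
  split_ifs with h
  · rfl
  · simpa [eq_comm] using h

/-! ### The Poisson bracket -/

/-- The Hamiltonian derivation `{g, ·}`. -/
def hamiltonian {n : ℕ} (a : Fin n → Fin n → ℤ) (g : Rp n) : Derivation ℂ (Rp n) (Rp n) :=
  ∑ j : Fin n, (∑ i : Fin n, C ((a i j : ℂ)) * X i * X j * pderiv i g) • pderiv j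

lemma derivation_sum_apply {n : ℕ} {ι : Type*} (s : Finset ι)
    (D : ι → Derivation ℂ (Rp n) (Rp n)) (x : Rp n) : (∑ i ∈ s, D i) x = ∑ i ∈ s, D i x := by
  have h := map_sum (Derivation.coeFnAddMonoidHom (R := ℂ) (A := Rp n) (M := Rp n)) D s
  have h' := congr_fun h x
  rwa [Finset.sum_apply] at h'

lemma pbL_apply {n : ℕ} (a : Fin n → Fin n → ℤ) (g m : Rp n) :
    pbL a g m = hamiltonian a g m := by
  simp [pbL, hamiltonian, LinearMap.sum_apply, derivation_sum_apply]

lemma hamiltonian_apply {n : ℕ} (a : Fin n → Fin n → ℤ) (g m : Rp n) :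
    hamiltonian a g m
      = ∑ s : Fin n, ∑ t : Fin n, C ((a s t : ℂ)) * X s * X t * pderiv s g * pderiv t m := by
  rw [Finset.sum_comm]
  simp [hamiltonian, derivation_sum_apply, Finset.sum_mul]

lemma hamiltonian_skew {n : ℕ} {a : Fin n → Fin n → ℤ} (ha : ∀ i j, a j i = - a i j)
    (g m : Rp n) : hamiltonian a g m = - hamiltonian a m g := by
  rw [hamiltonian_apply, hamiltonian_apply, Finset.sum_comm, ← Finset.sum_neg_distrib]
  refine Finset.sum_congr rfl fun s _ => ?_
  rw [← Finset.sum_neg_distrib]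
  refine Finset.sum_congr rfl fun t _ => ?_
  rw [ha s t]
  simp only [Int.cast_neg, map_neg]
  ring

lemma hamiltonian_X {n : ℕ} (a : Fin n → Fin n → ℤ) (p : Fin n) (m : Rp n) :
    hamiltonian a (X p) m = X p * ∑ j, (a p j : ℂ) • (X j * pderiv j m) := by
  rw [hamiltonian_apply, Finset.sum_eq_single p, Finset.mul_sum]
  · refine Finset.sum_congr rfl fun j _ => ?_
    rw [pderiv_X_self, smul_eq_C_mul]
    ring
  · intro s _ hs
    simp [pderiv_X_of_ne hs.symm]
  · simp

lemma hamiltonian_X_X {n : ℕ} (a : Fin n → Fin n → ℤ) (p q : Fin n) :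
    hamiltonian a (X p) (X q) = (a p q : ℂ) • (X p * X q : Rp n) := by
  rw [hamiltonian_X, Finset.sum_eq_single q]
  · simp
  · intro j _ hj
    simp [pderiv_X_of_ne hj.symm]
  · simp

/-! ### Multiderivations -/

/-- A cochain that is a derivation in each argument. -/
def IsMultiderivation {n k : ℕ} (P : W n k) : Prop :=
  ∀ (v : Fin k → Rp n) (i : Fin k),
    ∃ D : Derivation ℂ (Rp n) (Rp n), ∀ x, P (Function.update v i x) = D x

lemma IsMultiderivation.eq_of_eq_X {n k : ℕ} {P Q : W n k} (hP : IsMultiderivation P)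
    (hQ : IsMultiderivation Q)
    (h : ∀ s : Fin k → Fin n, P (fun l => X (s l)) = Q (fun l => X (s l))) : P = Q := by
  suffices H : ∀ (T : Finset (Fin k)) (f : Fin k → Rp n), (∀ i ∉ T, ∃ j, f i = X j) → P f = Q f from
    funext fun f => H Finset.univ f fun i hi => absurd (Finset.mem_univ i) hi
  intro T
  induction T using Finset.induction_on with
  | empty =>
    intro f hf
    choose s hs using fun i => hf i (Finset.notMem_empty i)
    rw [funext hs]
    exact h s
  | insert t T ht ih =>
    intro f hf
    obtain ⟨D, hD⟩ := hP f t
    obtain ⟨E, hE⟩ := hQ f t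
    have hDE : D = E := derivation_ext fun j => by
      rw [← hD, ← hE]
      refine ih _ fun i hi => ?_
      rcases eq_or_ne i t with rfl | hit
      · exact ⟨j, Function.update_self ..⟩
      · rw [Function.update_of_ne hit]
        exact hf i (by simp [hi, hit])
    rw [← Function.update_eq_self t f, hD, hE, hDE]

lemma isMultiderivation_of_mem_chiSub {n k : ℕ} {P : W n k} (hP : P ∈ chiSub n k) :
    IsMultiderivation P := fun v i =>
  ⟨Derivation.mk' ⟨⟨fun x => P (Function.update v i x), hP.1 v i⟩, hP.2.1 v i⟩
    (hP.2.2.2 v i), fun _ => rfl⟩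

/-- An element of `χ^k(R)` as an alternating map. -/
def chiAlternating {n k : ℕ} (P : W n k) (hP : P ∈ chiSub n k) :
    (Rp n) [⋀^Fin k]→ₗ[ℂ] (Rp n) where
  toFun := P
  map_update_add' v i x y := by
    convert hP.1 v i x y
  map_update_smul' v i c x := by
    convert hP.2.1 v i c x
  map_eq_zero_of_eq' v i j hv hij := by
    have h := hP.2.2.1 v (Equiv.swap i j)
    have hv' : v ∘ Equiv.swap i j = v := by
      funext l
      rcases eq_or_ne l i with rfl | hli
      · simp [hv]
      rcases eq_or_ne l j with rfl | hlj
      · simp [hv]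
      · simp [Equiv.swap_apply_of_ne_of_ne hli hlj]
    rw [hv', Equiv.Perm.sign_swap hij] at h
    have h' : P v = - P v := by simpa using h
    exact self_eq_neg.1 h'

lemma map_eq_zero_of_mem_chiSub {n k : ℕ} {P : W n k} (hP : P ∈ chiSub n k)
    {v : Fin k → Rp n} (hv : ¬ Function.Injective v) : P v = 0 :=
  (chiAlternating P hP).map_eq_zero_of_not_injective v hv

lemma neg_one_pow_smul_succAbove_eq {n k : ℕ} {P : W n k} (hP : P ∈ chiSub n k)
    {v : Fin (k + 1) → Rp n} {i j : Fin (k + 1)} (hv : v i = v j) (hij : i ≠ j) :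
    (-1 : ℂ) ^ (i : ℕ) • P (v ∘ i.succAbove) = - ((-1 : ℂ) ^ (j : ℕ) • P (v ∘ j.succAbove)) := by
  have h := (chiAlternating P hP).neg_one_pow_smul_map_removeNth_add_eq_zero_of_eq hv hij
  have e : ∀ (m : ℕ) (x : Rp n), (-1 : ℤ) ^ m • x = (-1 : ℂ) ^ m • x := fun m x => by
    rw [← Int.cast_smul_eq_zsmul ℂ]
    simp
  rw [e, e] at h
  exact eq_neg_of_add_eq_zero_left h

/-! ### The coboundary of a skew-symmetric multiderivation -/

lemma cmpl_succAbove {m : ℕ} (i : Fin (m + 2)) (j : Fin (m + 1)) (l : Fin m) :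
    cmpl i (i.succAbove j) l = i.succAbove (j.succAbove l) := by
  have h : (List.finRange (m + 2)).filter (fun x => decide (x ≠ i ∧ x ≠ i.succAbove j))
      = (List.finRange m).map fun x => i.succAbove (j.succAbove x) := by
    have h1 : ((List.finRange (m + 2)).filter
        (fun x => decide (x ≠ i ∧ x ≠ i.succAbove j))).Pairwise (· < ·) :=
      (List.pairwise_lt_finRange _).filter _
    have h2 : ((List.finRange m).map fun x => i.succAbove (j.succAbove x)).Pairwise (· < ·) := by
      rw [List.pairwise_map]
      exact (List.pairwise_lt_finRange m).imp fun h => by simpa using h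
    refine List.Perm.eq_of_pairwise' h1 h2 ((List.perm_ext_iff_of_nodup ?_ ?_).2 fun x => ?_)
    · exact h1.imp ne_of_lt
    · exact h2.imp ne_of_lt
    · simp only [List.mem_filter, List.mem_finRange, true_and, decide_eq_true_eq, List.mem_map]
      constructor
      · rintro ⟨hxi, hxj⟩
        obtain ⟨y, rfl⟩ := Fin.exists_succAbove_eq hxi
        obtain ⟨z, hz⟩ := Fin.exists_succAbove_eq (x := y) (y := j) (fun h => hxj (h ▸ rfl))
        exact ⟨z, by rw [hz]⟩
      · rintro ⟨z, rfl⟩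
        exact ⟨Fin.succAbove_ne _ _, fun h =>
          Fin.succAbove_ne _ _ (Fin.succAbove_right_injective h)⟩
  rw [cmpl, h]
  simp [List.getD_eq_getElem?_getD]

lemma map_update_comp_succAbove_of_mem_chiSub {n k : ℕ} {P : W n k} (hP : P ∈ chiSub n k)
    (f : Fin (k + 1) → Rp n) {i j : Fin (k + 1)} (hij : j ≠ i) :
    ∃ D : Derivation ℂ (Rp n) (Rp n), ∀ z, P (Function.update f j z ∘ i.succAbove) = D z := by
  obtain ⟨l, rfl⟩ := Fin.exists_succAbove_eq hij
  obtain ⟨D, hD⟩ := isMultiderivation_of_mem_chiSub hP (f ∘ i.succAbove) l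
  exact ⟨D, fun z => by
    rw [Function.update_comp_eq_of_injective _ Fin.succAbove_right_injective, hD]⟩

lemma update_comp_succAbove_self {n k : ℕ} (f : Fin (k + 1) → Rp n) (i : Fin (k + 1)) (z : Rp n) :
    Function.update f i z ∘ i.succAbove = f ∘ i.succAbove := by
  funext l
  simp

lemma neg_one_pow_smul_update_comp_succAbove {n k : ℕ} {P : W n k} (hP : P ∈ chiSub n k)
    (f : Fin (k + 1) → Rp n) {i j : Fin (k + 1)} (hij : i ≠ j) (z : Rp n) :
    (-1 : ℂ) ^ (i : ℕ) • P (Function.update f j z ∘ i.succAbove)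
      = - ((-1 : ℂ) ^ (j : ℕ) • P (Function.update f i z ∘ j.succAbove)) := by
  have h := neg_one_pow_smul_succAbove_eq hP
    (v := Function.update (Function.update f j z) i z) (i := i) (j := j)
    (by rw [Function.update_self, Function.update_of_ne hij.symm, Function.update_self]) hij
  rwa [update_comp_succAbove_self, Function.update_comm hij.symm, update_comp_succAbove_self] at h

/-- The summand of `δ P` involving the bracket `{f i, f j}`, which is put in place of `f j`. -/
def bracketTerm {n k : ℕ} (a : Fin n → Fin n → ℤ) (P : W n k) (f : Fin (k + 1) → Rp n)
    (i j : Fin (k + 1)) : Rp n :=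
  - ((-1 : ℂ) ^ (i : ℕ) • P (Function.update f j (hamiltonian a (f i) (f j)) ∘ i.succAbove))

lemma bracketTerm_comm {n k : ℕ} {a : Fin n → Fin n → ℤ} (ha : ∀ i j, a j i = - a i j)
    {P : W n k} (hP : P ∈ chiSub n k) (f : Fin (k + 1) → Rp n) {i j : Fin (k + 1)} (hij : i ≠ j) :
    bracketTerm a P f i j = bracketTerm a P f j i := by
  obtain ⟨D, hD⟩ := map_update_comp_succAbove_of_mem_chiSub hP f hij
  rw [bracketTerm, bracketTerm, neg_one_pow_smul_update_comp_succAbove hP f hij, neg_neg, hD, hD,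
    hamiltonian_skew ha, map_neg, smul_neg]

lemma smul_map_cmpl_eq_bracketTerm {n k : ℕ} (a : Fin n → Fin n → ℤ)
    {P : W n k} (hP : P ∈ chiSub n k) (f : Fin (k + 1) → Rp n) {i j : Fin (k + 1)} (hij : i < j) :
    (-1 : ℂ) ^ ((i : ℕ) + (j : ℕ)) • P (fun l : Fin k =>
        if (l : ℕ) = 0 then hamiltonian a (f i) (f j) else f (cmpl i j ((l : ℕ) - 1)))
      = bracketTerm a P f i j := by
  obtain ⟨j, rfl⟩ := Fin.exists_succAbove_eq hij.ne'
  obtain ⟨m, rfl⟩ : ∃ m, k = m + 1 := ⟨k - 1, by have := j.pos; omega⟩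
  have hj : ((i.succAbove j : Fin (m + 2)) : ℕ) = j + 1 := by
    rw [Fin.succAbove_of_le_castSucc _ _ ((Fin.lt_succAbove_iff_le_castSucc i j).1 hij),
      Fin.val_succ]
  rw [bracketTerm, Function.update_comp_eq_of_injective _ Fin.succAbove_right_injective]
  generalize hamiltonian a (f i) (f (i.succAbove j)) = z
  have h1 : Function.update (f ∘ i.succAbove) j z
      = j.insertNth z ((f ∘ i.succAbove) ∘ j.succAbove) := by
    rw [Fin.eq_insertNth_iff]
    refine ⟨Function.update_self .., ?_⟩
    funext l
    simp [Fin.removeNth]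
  have h2 : (fun l : Fin (m + 1) => if (l : ℕ) = 0 then z
        else f (cmpl i (i.succAbove j) ((l : ℕ) - 1)))
      = Matrix.vecCons z ((f ∘ i.succAbove) ∘ j.succAbove) := by
    funext l
    refine Fin.cases ?_ (fun l => ?_) l
    · simp
    · simp [cmpl_succAbove]
  have h3 := (chiAlternating P hP).map_insertNth j z ((f ∘ i.succAbove) ∘ j.succAbove)
  rw [← Int.cast_smul_eq_zsmul ℂ] at h3
  rw [h1, h2, hj]
  change P _ = _ • P _ at h3
  rw [h3]
  push_cast
  rw [smul_smul, ← neg_smul]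
  congr 1
  rw [pow_add, pow_succ]
  ring

lemma dltL_apply_eq {n k : ℕ} (a : Fin n → Fin n → ℤ)
    {P : W n k} (hP : P ∈ chiSub n k) (f : Fin (k + 1) → Rp n) :
    dltL a k P f = (∑ i : Fin (k + 1),
        (-1 : ℂ) ^ (i : ℕ) • hamiltonian a (f i) (P (f ∘ i.succAbove)))
      + ∑ i : Fin (k + 1), ∑ j : Fin (k + 1), if i < j then bracketTerm a P f i j else 0 := by
  simp only [dltL, LinearMap.pi_apply, LinearMap.add_apply, LinearMap.sum_apply,
    LinearMap.smul_apply, LinearMap.comp_apply, LinearMap.proj_apply, pbL_apply]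
  congr 1
  refine Finset.sum_congr rfl fun i _ => Finset.sum_congr rfl fun j _ => ?_
  split_ifs with hij
  · rw [LinearMap.smul_apply, LinearMap.proj_apply, ← smul_map_cmpl_eq_bracketTerm a hP f hij]
    simp only [hamiltonian_apply]
  · rfl

lemma sum_lt_eq_of_symm {k : ℕ} {M : Type*} [AddCommMonoid M] {g : Fin k → Fin k → M}
    (hg : ∀ i j, i ≠ j → g i j = g j i) (j : Fin k) :
    ∑ i, ∑ l, (if i < l then g i l else 0)
      = ∑ i, (if i = j then 0 else g i j)
        + ∑ i, ∑ l, if i < l ∧ i ≠ j ∧ l ≠ j then g i l else 0 := by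
  have h : ∀ i l, (if i < l then g i l else 0) = ((if i = j then if j < l then g l j else 0 else 0)
      + (if l = j then if i < j then g i j else 0 else 0))
      + if i < l ∧ i ≠ j ∧ l ≠ j then g i l else 0 := by
    intro i l
    by_cases h1 : i = j
    · subst h1
      by_cases h2 : l = i
      · simp [h2]
      · simp [h2, hg l i h2]
    · by_cases h2 : l = j
      · simp [h1, h2]
      · simp [h1, h2]
  rw [Finset.sum_congr rfl fun i _ => Finset.sum_congr rfl fun l _ => h i l]
  simp only [Finset.sum_add_distrib]
  congr 1
  rw [Finset.sum_comm]
  simp only [Finset.sum_ite_eq', Finset.mem_univ, if_true]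
  rw [← Finset.sum_add_distrib]
  refine Finset.sum_congr rfl fun i _ => ?_
  rcases lt_trichotomy i j with h1 | rfl | h1
  · simp [h1, h1.ne, h1.not_gt]
  · simp
  · simp [h1, h1.ne', h1.not_gt]

lemma sum_lt_add_swap {k : ℕ} {M : Type*} [AddCommMonoid M] {u : Fin k → Fin k → M}
    (hu : ∀ i, u i i = 0) :
    ∑ i, ∑ l, (if i < l then u i l + u l i else 0) = ∑ i, ∑ l, u i l := by
  have h : ∀ i l, u i l = (if i < l then u i l else 0) + if l < i then u i l else 0 := by
    intro i l
    rcases lt_trichotomy i l with h1 | rfl | h1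
    · simp [h1, h1.not_gt]
    · simp [hu]
    · simp [h1, h1.not_gt]
  have h' : ∀ i l, (if i < l then u i l + u l i else 0)
      = (if i < l then u i l else 0) + if i < l then u l i else 0 := by
    intro i l
    split_ifs <;> simp
  simp only [h']
  conv_rhs => rw [Finset.sum_congr rfl fun i _ => Finset.sum_congr rfl fun l _ => h i l]
  simp only [Finset.sum_add_distrib]
  congr 1
  exact Finset.sum_comm

/-- The map `F` is a derivation of the polynomial algebra. -/
def IsDeriv {n : ℕ} (F : Rp n → Rp n) : Prop :=
  ∃ D : Derivation ℂ (Rp n) (Rp n), ∀ x, F x = D x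

lemma IsDeriv.add {n : ℕ} {F G : Rp n → Rp n} (hF : IsDeriv F) (hG : IsDeriv G) :
    IsDeriv fun x => F x + G x := by
  obtain ⟨D, hD⟩ := hF
  obtain ⟨E, hE⟩ := hG
  exact ⟨D + E, fun x => by simp [hD, hE]⟩

lemma IsDeriv.smul {n : ℕ} {F : Rp n → Rp n} (c : ℂ) (hF : IsDeriv F) :
    IsDeriv fun x => c • F x := by
  obtain ⟨D, hD⟩ := hF
  exact ⟨c • D, fun x => by simp [hD]⟩

lemma isDeriv_zero {n : ℕ} : IsDeriv fun _ : Rp n => 0 := ⟨0, fun _ => rfl⟩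

lemma IsDeriv.sum {n : ℕ} {ι : Type*} {s : Finset ι} {F : ι → Rp n → Rp n}
    (hF : ∀ i ∈ s, IsDeriv (F i)) : IsDeriv fun x => ∑ i ∈ s, F i x := by
  classical
  induction s using Finset.induction_on with
  | empty => simpa using isDeriv_zero
  | insert i s hi ih =>
    simp only [Finset.sum_insert hi]
    exact (hF i (by simp)).add (ih fun j hj => hF j (by simp [hj]))

lemma isMultiderivation_dltL {n k : ℕ} {a : Fin n → Fin n → ℤ} (ha : ∀ i j, a j i = - a i j)
    {P : W n k} (hP : P ∈ chiSub n k) : IsMultiderivation (dltL a k P) := by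
  intro v j
  change IsDeriv _
  have key : (fun z => dltL a k P (Function.update v j z)) = fun z =>
      (∑ i, if i = j then (-1 : ℂ) ^ (j : ℕ) • hamiltonian a z (P (v ∘ j.succAbove)) else
        (-1 : ℂ) ^ (i : ℕ) • (hamiltonian a (v i) (P (Function.update v j z ∘ i.succAbove))
          + (-1 : ℂ) • P (Function.update v j (hamiltonian a (v i) z) ∘ i.succAbove)))
      + ∑ i, ∑ l, if i < l ∧ i ≠ j ∧ l ≠ j then
        (-1 : ℂ) • (-1 : ℂ) ^ (i : ℕ) •
          P (Function.update (Function.update v l (hamiltonian a (v i) (v l))) j z ∘ i.succAbove)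
        else 0 := by
    funext z
    rw [dltL_apply_eq a hP, sum_lt_eq_of_symm
      (g := bracketTerm a P (Function.update v j z)) (fun i l hil => bracketTerm_comm ha hP _ hil) j,
      ← add_assoc, ← Finset.sum_add_distrib]
    congr 1
    · refine Finset.sum_congr rfl fun i _ => ?_
      split_ifs with hij
      · subst hij
        rw [Function.update_self, update_comp_succAbove_self, add_zero]
      · rw [bracketTerm, Function.update_of_ne hij, Function.update_self, Function.update_idem,
          smul_add, ← sub_eq_add_neg, sub_eq_add_neg, neg_one_smul, smul_neg]
    · refine Finset.sum_congr rfl fun i _ => Finset.sum_congr rfl fun l _ => ?_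
      split_ifs with h
      · rw [bracketTerm, Function.update_of_ne h.2.1, Function.update_of_ne h.2.2,
          Function.update_comm h.2.2, neg_one_smul]
      · rfl
  rw [show (fun x => dltL a k P (Function.update v j x)) = _ from key]
  refine IsDeriv.add (IsDeriv.sum fun i _ => ?_)
    (IsDeriv.sum fun i _ => IsDeriv.sum fun l _ => ?_)
  · by_cases hij : i = j
    · simp only [if_pos hij]
      refine IsDeriv.smul _ ⟨-hamiltonian a (P (v ∘ j.succAbove)), fun x => ?_⟩
      beta_reduce
      rw [hamiltonian_skew ha]
      rfl
    · simp only [if_neg hij]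
      obtain ⟨D, hD⟩ := map_update_comp_succAbove_of_mem_chiSub hP v (Ne.symm hij)
      refine IsDeriv.smul _ ⟨⁅hamiltonian a (v i), D⁆, fun x => ?_⟩
      beta_reduce
      rw [hD, hD, Derivation.commutator_apply, neg_one_smul, sub_eq_add_neg]
  · by_cases h : i < l ∧ i ≠ j ∧ l ≠ j
    · simp only [if_pos h]
      exact IsDeriv.smul _ (IsDeriv.smul _
        (map_update_comp_succAbove_of_mem_chiSub hP _ h.2.1.symm))
    · simp only [if_neg h]
      exact isDeriv_zero

lemma dltL_apply_X {n k : ℕ} {a : Fin n → Fin n → ℤ} (ha : ∀ i j, a j i = - a i j)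
    {P : W n k} (hP : P ∈ chiSub n k) (s : Fin (k + 1) → Fin n) :
    dltL a k P (fun l => X (s l)) = ∑ i : Fin (k + 1), (-1 : ℂ) ^ (i : ℕ) •
      (X (s i) * ∑ j, (a (s i) j : ℂ) • (X j * pderiv j (P fun l => X (s (i.succAbove l))))
        - ∑ l, (a (s i) (s l) : ℂ) • (X (s i) * P fun l => X (s (i.succAbove l)))) := by
  have h0 : ∀ p, a p p = 0 := fun p => self_eq_neg.1 (ha p p)
  have h : ∀ i l, i ≠ l → bracketTerm a P (fun l => X (s l)) i l
      = -((-1 : ℂ) ^ (i : ℕ) • (a (s i) (s l) : ℂ) •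
            (X (s i) * P fun l => X (s (i.succAbove l))))
        + -((-1 : ℂ) ^ (l : ℕ) • (a (s l) (s i) : ℂ) •
            (X (s l) * P fun m => X (s (l.succAbove m)))) := by
    intro i l hil
    obtain ⟨D, hD⟩ := map_update_comp_succAbove_of_mem_chiSub hP
      (fun l => (X (s l) : Rp n)) hil.symm
    have h1 : D (X (s l)) = P fun l => X (s (i.succAbove l)) := by
      rw [← hD, Function.update_eq_self_iff.2 rfl]
      rfl
    have h2 : (-1 : ℂ) ^ (i : ℕ) • D (X (s i))
        = -((-1 : ℂ) ^ (l : ℕ) • P fun m => X (s (l.succAbove m))) := by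
      rw [← hD, neg_one_pow_smul_update_comp_succAbove hP _ hil, Function.update_eq_self_iff.2 rfl]
      rfl
    have h3 : (-1 : ℂ) ^ (i : ℕ) • (X (s l) * D (X (s i)))
        = -((-1 : ℂ) ^ (l : ℕ) • (X (s l) * P fun m => X (s (l.succAbove m)))) := by
      rw [← mul_smul_comm, h2, mul_neg, mul_smul_comm]
    rw [bracketTerm, hD, hamiltonian_X_X, Derivation.map_smul, Derivation.leibniz, h1, smul_eq_mul,
      smul_eq_mul, ha (s i) (s l), smul_comm, smul_add, h3]
    push_cast
    module
  rw [dltL_apply_eq a hP]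
  have h' : ∀ i l, (if i < l then bracketTerm a P (fun l => X (s l)) i l else 0)
      = if i < l then _ + _ else 0 := fun i l => if_ctx_congr Iff.rfl (fun hil => h i l hil.ne)
        fun _ => rfl
  simp only [h']
  rw [sum_lt_add_swap (u := fun i l => -((-1 : ℂ) ^ (i : ℕ) • (a (s i) (s l) : ℂ) •
            (X (s i) * P fun l => X (s (i.succAbove l))))) (fun i => by simp [h0]),
    ← Finset.sum_add_distrib]
  refine Finset.sum_congr rfl fun i _ => ?_
  rw [hamiltonian_X, smul_sub, Finset.smul_sum, Finset.sum_neg_distrib, ← sub_eq_add_neg]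
  rfl

/-! ### Weight components -/

/-- The sum of the standard basis vectors indexed by `s`. -/
def expSum {n k : ℕ} (s : Fin k → Fin n) : Fin n → ℤ := ∑ l, Pi.single (s l) 1

lemma expSum_succAbove {n k : ℕ} (s : Fin (k + 1) → Fin n) (i : Fin (k + 1)) :
    expSum s = Pi.single (s i) 1 + expSum fun l => s (i.succAbove l) :=
  Fin.sum_univ_succAbove _ i

lemma expSum_comp_perm {n k : ℕ} (s : Fin k → Fin n) (g : Equiv.Perm (Fin k)) :
    expSum (s ∘ g) = expSum s :=
  Equiv.sum_comp g fun l => (Pi.single (s l) 1 : Fin n → ℤ)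

lemma expSum_apply_of_notMem {n k : ℕ} {s : Fin k → Fin n} {p : Fin n} (h : ∀ l, s l ≠ p) :
    expSum s p = 0 := by
  rw [expSum, Finset.sum_apply]
  exact Finset.sum_eq_zero fun l _ => Pi.single_eq_of_ne (h l).symm _

lemma expSum_apply_of_injective {n k : ℕ} {s : Fin k → Fin n} (hs : Function.Injective s)
    (l : Fin k) : expSum s (s l) = 1 := by
  rw [expSum, Finset.sum_apply, Finset.sum_eq_single l]
  · simp
  · exact fun m _ hm => Pi.single_eq_of_ne (fun h => hm (hs h.symm)) _
  · simp

lemma sum_mul_expSum {n k : ℕ} (s : Fin k → Fin n) (u : Fin n → ℤ) :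
    ∑ j, u j * expSum s j = ∑ l, u (s l) := by
  simp only [expSum, Finset.sum_apply, Finset.mul_sum]
  rw [Finset.sum_comm]
  refine Finset.sum_congr rfl fun l _ => ?_
  simp [Pi.single_apply]

/-- The coefficients of the component of weight `w` of a cochain, with respect to the
logarithmic vector fields `X_i ∂_i`. -/
def weightCoeff {n k : ℕ} (P : W n k) (w : Fin n → ℤ) (s : Fin k → Fin n) : ℂ :=
  coeffInt (w + expSum s) (P fun l => X (s l))

/-- The coboundary acts on the component of weight `w` as the exterior product with the
vector `A w`. -/
lemma weightCoeff_dltL {n k : ℕ} {a : Fin n → Fin n → ℤ} (ha : ∀ i j, a j i = - a i j)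
    {P : W n k} (hP : P ∈ chiSub n k) (w : Fin n → ℤ) (s : Fin (k + 1) → Fin n) :
    weightCoeff (dltL a k P) w s = ∑ i : Fin (k + 1), (-1 : ℂ) ^ (i : ℕ) *
      (((∑ j, a (s i) j * w j : ℤ) : ℂ) * weightCoeff P w fun l => s (i.succAbove l)) := by
  have h0 : ∀ p, a p p = 0 := fun p => self_eq_neg.1 (ha p p)
  rw [weightCoeff, dltL_apply_X ha hP, map_sum]
  refine Finset.sum_congr rfl fun i _ => ?_
  have hw : w + expSum s - Pi.single (s i) 1 = w + expSum fun l => s (i.succAbove l) := by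
    rw [expSum_succAbove s i]
    abel
  have hsum : ∑ j, a (s i) j * w j
      = ∑ j, a (s i) j * (w + expSum fun l => s (i.succAbove l)) j - ∑ l, a (s i) (s l) := by
    simp only [Pi.add_apply, mul_add, Finset.sum_add_distrib, sum_mul_expSum]
    rw [Fin.sum_univ_succAbove (fun l => a (s i) (s l)) i, h0]
    ring
  rw [map_smul, map_sub, coeffInt_X_mul, hw, map_sum, map_sum, smul_eq_mul, hsum]
  simp only [map_smul, coeffInt_X_mul_pderiv, smul_eq_mul, weightCoeff]
  simp only [coeffInt_X_mul, hw]
  rw [← Finset.sum_mul]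
  simp only [← mul_assoc]
  rw [← Finset.sum_mul]
  push_cast
  ring

lemma weightCoeff_eq_zero_of_not_injective {n k : ℕ} {P : W n k} (hP : P ∈ chiSub n k)
    (w : Fin n → ℤ) {s : Fin k → Fin n} (hs : ¬ Function.Injective s) :
    weightCoeff P w s = 0 := by
  rw [weightCoeff, map_eq_zero_of_mem_chiSub hP, map_zero]
  exact fun h => hs fun i j hij => h (by simp [hij])

lemma weightCoeff_comp_perm {n k : ℕ} {P : W n k} (hP : P ∈ chiSub n k)
    (w : Fin n → ℤ) (s : Fin k → Fin n) (g : Equiv.Perm (Fin k)) :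
    weightCoeff P w (s ∘ g) = ((Equiv.Perm.sign g : ℤ) : ℂ) * weightCoeff P w s := by
  rw [weightCoeff, expSum_comp_perm, weightCoeff, ← smul_eq_mul, ← map_smul, ← hP.2.2.1]
  rfl

lemma IsMultiderivation.eq_of_weightCoeff_eq {n k : ℕ} {P Q : W n k} (hP : IsMultiderivation P)
    (hQ : IsMultiderivation Q) (h : ∀ w s, weightCoeff P w s = weightCoeff Q w s) : P = Q := by
  refine hP.eq_of_eq_X hQ fun s => eq_of_coeffInt_eq fun ν => ?_
  simpa [weightCoeff] using h (ν - expSum s) s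

/-- The cochain with values `c s` on the tuples of variables `X ∘ s`. -/
def cochainOfCoeff {n k : ℕ} (c : (Fin k → Fin n) → Rp n) : W n k := fun f =>
  ∑ s, c s * ∏ l, pderiv (s l) (f l)

lemma cochainOfCoeff_apply_X {n k : ℕ} (c : (Fin k → Fin n) → Rp n) (t : Fin k → Fin n) :
    cochainOfCoeff c (fun l => X (t l)) = c t := by
  rw [cochainOfCoeff, Finset.sum_eq_single t]
  · simp
  · intro s _ hs
    obtain ⟨l, hl⟩ := Function.ne_iff.1 hs
    rw [Finset.prod_eq_zero (Finset.mem_univ l), mul_zero]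
    exact pderiv_X_of_ne hl.symm
  · simp

lemma cochainOfCoeff_update {n k : ℕ} (c : (Fin k → Fin n) → Rp n) (v : Fin k → Rp n)
    (i : Fin k) (z : Rp n) : cochainOfCoeff c (Function.update v i z)
      = ∑ s, (c s * ∏ l ∈ Finset.univ.erase i, pderiv (s l) (v l)) * pderiv (s i) z := by
  refine Finset.sum_congr rfl fun s _ => ?_
  rw [← Finset.prod_erase_mul _ _ (Finset.mem_univ i), Function.update_self, mul_assoc]
  congr 2
  refine Finset.prod_congr rfl fun l hl => ?_
  rw [Function.update_of_ne (Finset.ne_of_mem_erase hl)]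

lemma cochainOfCoeff_mem_chiSub {n k : ℕ} {c : (Fin k → Fin n) → Rp n}
    (hc : ∀ s (g : Equiv.Perm (Fin k)), c (s ∘ g) = ((Equiv.Perm.sign g : ℤ) : ℂ) • c s) :
    cochainOfCoeff c ∈ chiSub n k := by
  refine ⟨fun v i x y => ?_, fun v i r x => ?_, fun v g => ?_, fun v i x y => ?_⟩
  · simp only [cochainOfCoeff_update, map_add, mul_add, Finset.sum_add_distrib]
  · simp only [cochainOfCoeff_update, Derivation.map_smul, mul_smul_comm, Finset.smul_sum]
  · simp only [cochainOfCoeff, Finset.smul_sum]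
    refine Fintype.sum_equiv (g.arrowCongr (Equiv.refl _)) _ _ fun s => ?_
    have h := hc (s ∘ g.symm) g
    have h' : (s ∘ g.symm) ∘ g = s := by funext l; simp
    rw [h'] at h
    rw [h, smul_mul_assoc]
    congr 2
    refine Fintype.prod_equiv g _ _ fun l => ?_
    simp
  · simp only [cochainOfCoeff_update, Derivation.leibniz, mul_add, Finset.sum_add_distrib,
      smul_eq_mul, Finset.mul_sum]
    congr 1 <;> exact Finset.sum_congr rfl fun s _ => by ring

/-! ### Resonant weights -/

/-- The weights `w = γ - 1` with `γ ∈ C`. -/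
def IsResonant {n : ℕ} (a : Fin n → Fin n → ℤ) (w : Fin n → ℤ) : Prop :=
  ∀ i, w i = -1 ∨ ∑ j, a i j * w j = 0

lemma weightCoeff_dltL_of_isResonant {n k : ℕ} {a : Fin n → Fin n → ℤ}
    (ha : ∀ i j, a j i = - a i j) {P : W n k} (hP : P ∈ chiSub n k) {w : Fin n → ℤ}
    (hw : IsResonant a w) {s : Fin (k + 1) → Fin n} (hs : Function.Injective s) :
    weightCoeff (dltL a k P) w s = 0 := by
  rw [weightCoeff_dltL ha hP]
  refine Finset.sum_eq_zero fun i _ => ?_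
  rcases hw (s i) with h | h
  · by_cases h' : weightCoeff P w (fun l => s (i.succAbove l)) = 0
    · simp [h']
    · have := nonneg_of_coeffInt_ne_zero h' (s i)
      rw [Pi.add_apply, h, expSum_apply_of_notMem fun l hl => Fin.succAbove_ne i l (hs hl)] at this
      omega
  · simp [h]

lemma dltL_eq_zero_of_isResonant {n k : ℕ} {a : Fin n → Fin n → ℤ}
    (ha : ∀ i j, a j i = - a i j) {P : W n k} (hP : P ∈ chiSub n k)
    (h : ∀ w s, weightCoeff P w s ≠ 0 → IsResonant a w) : dltL a k P = 0 := by
  refine (isMultiderivation_dltL ha hP).eq_of_weightCoeff_eq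
    (fun v i => ⟨0, fun x => rfl⟩) fun w s => ?_
  have h0 : weightCoeff (0 : W n (k + 1)) w s = 0 := by simp [weightCoeff]
  rw [h0]
  by_cases hw : IsResonant a w
  · by_cases hs : Function.Injective s
    · exact weightCoeff_dltL_of_isResonant ha hP hw hs
    · obtain ⟨i, j, hij, hne⟩ : ∃ i j, s i = s j ∧ i ≠ j := by
        simpa [Function.Injective] using hs
      rw [weightCoeff_dltL ha hP, Finset.sum_eq_add i j hne]
      · have hX := congrArg (coeffInt (w + expSum fun l => s (i.succAbove l)))
          (neg_one_pow_smul_succAbove_eq hP (v := fun l => X (s l)) (by rw [hij]) hne)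
        have hexp : expSum (fun l => s (i.succAbove l)) = expSum fun l => s (j.succAbove l) := by
          have := (expSum_succAbove s i).symm.trans (expSum_succAbove s j)
          rw [hij] at this
          exact add_left_cancel this
        rw [map_neg, map_smul, map_smul, smul_eq_mul, smul_eq_mul] at hX
        conv_rhs at hX => rw [hexp]
        change _ * weightCoeff P w (fun l => s (i.succAbove l))
          = -(_ * weightCoeff P w fun l => s (j.succAbove l)) at hX
        rw [hij]
        linear_combination ((∑ m, a (s j) m * w m : ℤ) : ℂ) * hX
      · intro m _ hm
        rw [weightCoeff_eq_zero_of_not_injective hP, mul_zero, mul_zero]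
        intro hinj
        obtain ⟨i', rfl⟩ := Fin.exists_succAbove_eq hm.1.symm
        obtain ⟨j', rfl⟩ := Fin.exists_succAbove_eq hm.2.symm
        exact hne (congrArg _ (hinj hij))
      · simp
      · simp
  · rw [weightCoeff_dltL ha hP]
    refine Finset.sum_eq_zero fun i _ => ?_
    rw [not_not.1 fun h' => hw (h w _ h'), mul_zero, mul_zero]

/-! ### The contracting homotopy -/

lemma cons_comp_perm {n m : ℕ} (q : Fin n) (s : Fin m → Fin n) (g : Equiv.Perm (Fin m)) :
    (Fin.cons q (s ∘ g) : Fin (m + 1) → Fin n)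
      = (Fin.cons q s : Fin (m + 1) → Fin n) ∘ Equiv.Perm.decomposeFin.symm (0, g) := by
  funext l
  refine Fin.cases ?_ (fun l => ?_) l
  · simp
  · simp [Equiv.Perm.decomposeFin_symm_apply_succ]

lemma expSum_cons {n m : ℕ} (q : Fin n) (s : Fin m → Fin n) :
    expSum (Fin.cons q s : Fin (m + 1) → Fin n) = Pi.single q 1 + expSum s := by
  rw [expSum_succAbove _ 0]
  simp

lemma finite_support_weightCoeff_cons {n m : ℕ} (P : W n (m + 1)) (p : (Fin n → ℤ) → Fin n)
    (r : (Fin n → ℤ) → ℂ) (s : Fin m → Fin n) :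
    (Function.support fun μ : Fin n →₀ ℕ =>
      r ((fun i => (μ i : ℤ)) - expSum s) * weightCoeff P ((fun i => (μ i : ℤ)) - expSum s)
        (Fin.cons (p ((fun i => (μ i : ℤ)) - expSum s)) s)).Finite := by
  have hfin : ∀ q : Fin n, {μ : Fin n →₀ ℕ | coeff (μ + Finsupp.single q 1)
      (P fun l => X ((Fin.cons q s : Fin (m + 1) → Fin n) l)) ≠ 0}.Finite := by
    intro q
    refine Set.Finite.subset (Set.Finite.preimage (f := fun μ => μ + Finsupp.single q 1)
      (fun x _ y _ h => add_right_cancel h)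
      (P fun l => X ((Fin.cons q s : Fin (m + 1) → Fin n) l)).support.finite_toSet) fun μ hμ => ?_
    exact mem_support_iff.2 hμ
  refine (Set.finite_iUnion hfin).subset fun μ hμ => ?_
  refine Set.mem_iUnion.2 ⟨p ((fun i => (μ i : ℤ)) - expSum s), ?_⟩
  have h := right_ne_zero_of_mul hμ
  rw [weightCoeff, expSum_cons] at h
  rw [Set.mem_ofPred, ← coeffInt_natCast]
  convert h using 2
  congr 1
  funext i
  simp [Finsupp.single_apply, Pi.single_apply, eq_comm]

/-- The interior product of a multiderivation with a weight-dependent logarithmic form. -/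
lemma exists_contraction {n m : ℕ} {P : W n (m + 1)} (hP : P ∈ chiSub n (m + 1))
    (p : (Fin n → ℤ) → Fin n) (r : (Fin n → ℤ) → ℂ) (hpr : ∀ w, r w ≠ 0 → w (p w) ≠ -1) :
    ∃ Q ∈ chiSub n m, ∀ w s, weightCoeff Q w s = r w * weightCoeff P w (Fin.cons (p w) s) := by
  choose c hc using fun s : Fin m → Fin n => exists_coeff_eq _
    (finite_support_weightCoeff_cons P p r s)
  refine ⟨cochainOfCoeff c, cochainOfCoeff_mem_chiSub fun s g => ?_, fun w s => ?_⟩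
  · ext μ
    rw [coeff_smul, hc, hc, expSum_comp_perm, cons_comp_perm, weightCoeff_comp_perm hP,
      Equiv.Perm.decomposeFin.symm_sign, if_pos rfl, one_mul, smul_eq_mul]
    ring
  · rw [weightCoeff, cochainOfCoeff_apply_X]
    rcases exists_natCast_or_exists_neg (w + expSum s) with ⟨μ, hμ⟩ | ⟨i, hi⟩
    · rw [hμ, coeffInt_natCast, hc, ← hμ, add_sub_cancel_right]
    · rw [coeffInt_of_neg hi]
      by_contra h
      have h := Ne.symm h
      have hr := hpr w (left_ne_zero_of_mul h)
      have hw := right_ne_zero_of_mul h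
      have hnot : ∀ l, s l ≠ p w := by
        intro l hl
        refine hw (weightCoeff_eq_zero_of_not_injective hP w fun hinj => ?_)
        exact Fin.succ_ne_zero l (hinj (by simpa using hl))
      have hnn := nonneg_of_coeffInt_ne_zero hw i
      rw [expSum_cons] at hnn
      simp only [Pi.add_apply] at hnn hi
      by_cases hip : i = p w
      · subst hip
        rw [expSum_apply_of_notMem hnot] at hnn hi
        simp only [Pi.single_eq_same] at hnn
        omega
      · rw [Pi.single_eq_of_ne hip] at hnn
        omega

lemma mem_Bcoh_of_weightCoeff_eq_zero {n k : ℕ} (hn : 1 ≤ n) {a : Fin n → Fin n → ℤ}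
    (ha : ∀ i j, a j i = - a i j) {P : W n k} (hP : P ∈ chiSub n k) (hd : dltL a k P = 0)
    (h : ∀ w s, IsResonant a w → weightCoeff P w s = 0) : P ∈ Bcoh n a k := by
  classical
  have hex : ∀ w, ∃ i : Fin n, ¬ IsResonant a w → w i ≠ -1 ∧ ∑ j, a i j * w j ≠ 0 := by
    intro w
    by_cases hw : IsResonant a w
    · exact ⟨⟨0, hn⟩, fun h' => absurd hw h'⟩
    · rw [IsResonant] at hw
      push Not at hw
      exact hw.imp fun i hi _ => hi
  choose p hp using hex
  have hcons : ∀ w (s : Fin k → Fin n), weightCoeff (dltL a k P) w (Fin.cons (p w) s) = 0 := by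
    intro w s
    simp [hd, weightCoeff]
  simp only [weightCoeff_dltL ha hP, Fin.sum_univ_succ (n := k), Fin.cons_zero,
    Fin.succAbove_zero, Fin.cons_succ, Fin.val_zero, pow_zero, one_mul] at hcons
  cases k with
  | zero =>
    refine (isMultiderivation_of_mem_chiSub hP).eq_of_weightCoeff_eq
      (fun v i => ⟨0, fun x => rfl⟩) fun w s => ?_
    rw [show weightCoeff (0 : W n 0) w s = 0 by simp [weightCoeff]]
    by_cases hw : IsResonant a w
    · exact h w s hw
    · have h' := hcons w s
      rw [Fin.sum_univ_zero, add_zero] at h'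
      exact (mul_eq_zero.1 h').resolve_left (Int.cast_ne_zero.2 (hp w hw).2)
  | succ m =>
    obtain ⟨Q, hQ, hQw⟩ := exists_contraction hP p
      (fun w => if IsResonant a w then 0 else ((∑ j, a (p w) j * w j : ℤ) : ℂ)⁻¹)
      (fun w hw => (hp w fun h' => hw (if_pos h')).1)
    refine ⟨Q, hQ, (isMultiderivation_dltL ha hQ).eq_of_weightCoeff_eq
      (isMultiderivation_of_mem_chiSub hP) fun w s => ?_⟩
    simp only [weightCoeff_dltL ha hQ, hQw]
    by_cases hw : IsResonant a w
    · simp [hw, h w s hw]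
    · have h' := hcons w s
      have hv : ((∑ j, a (p w) j * w j : ℤ) : ℂ) ≠ 0 := Int.cast_ne_zero.2 (hp w hw).2
      have hs : ∀ i : Fin (m + 1), (fun l => (Fin.cons (p w) s : Fin (m + 2) → Fin n)
          (i.succ.succAbove l)) = Fin.cons (p w) fun l => s (i.succAbove l) := by
        intro i
        funext l
        refine Fin.cases ?_ (fun l => ?_) l <;> simp
      simp only [hs] at h'
      refine mul_left_cancel₀ hv ?_
      rw [eq_neg_of_add_eq_zero_left h', Finset.mul_sum, ← Finset.sum_neg_distrib]
      refine Finset.sum_congr rfl fun i _ => ?_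
      rw [if_neg hw, Fin.val_succ, pow_succ]
      field_simp

/-! ### The isomorphism -/

section Idx

variable {n k : ℕ} {a : Fin n → Fin n → ℤ}

/-- The increasing enumeration of the complement of `β`, for an index `(α, β)`. -/
def IdxC.enum (hk : k ≤ n) (p : IdxC n a k) : Fin k → Fin n :=
  (p.1.2ᶜ).orderEmbOfFin (k := k) (by
    rw [Finset.card_compl, p.2.1, Fintype.card_fin]
    omega)

/-- The weight of the multivector field corresponding to an index. -/
def IdxC.weight (hk : k ≤ n) (p : IdxC n a k) : Fin n → ℤ :=
  (fun i => (p.1.1 i : ℤ)) - expSum (p.enum hk)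

lemma IdxC.enum_injective (hk : k ≤ n) (p : IdxC n a k) : Function.Injective (p.enum hk) :=
  (Finset.orderEmbOfFin _ _).injective

lemma IdxC.range_enum (hk : k ≤ n) (p : IdxC n a k) : Set.range (p.enum hk) = ↑(p.1.2ᶜ) :=
  Finset.range_orderEmbOfFin _ _

lemma expSum_apply_eq_ite {s : Fin k → Fin n} (hs : Function.Injective s) {β : Finset (Fin n)}
    (hβ : Set.range s = ↑βᶜ) (i : Fin n) : expSum s i = 1 - if i ∈ β then 1 else 0 := by
  by_cases hi : i ∈ β
  · rw [if_pos hi, expSum_apply_of_notMem, sub_self]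
    intro l hl
    have : i ∈ Set.range s := ⟨l, hl⟩
    rw [hβ] at this
    simp [hi] at this
  · have : i ∈ Set.range s := by
      rw [hβ]
      simpa using hi
    obtain ⟨l, rfl⟩ := this
    rw [if_neg hi, expSum_apply_of_injective hs, sub_zero]

lemma csetPred_iff_isResonant {s : Fin k → Fin n} (hs : Function.Injective s)
    {β : Finset (Fin n)} (hβ : Set.range s = ↑βᶜ) (α : Fin n → ℕ) :
    CsetPred a (fun i => α i + if i ∈ β then 1 else 0)
      ↔ IsResonant a ((fun i => (α i : ℤ)) - expSum s) := by
  have h : ∀ i, ((fun i => (α i : ℤ)) - expSum s) i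
      = ((α i + if i ∈ β then 1 else 0 : ℕ) : ℤ) - 1 := by
    intro i
    rw [Pi.sub_apply, expSum_apply_eq_ite hs hβ]
    push_cast
    ring
  rw [CsetPred, IsResonant]
  simp only [h]
  refine forall_congr' fun i => or_congr ?_ Iff.rfl
  omega

lemma IdxC.isResonant_weight (hk : k ≤ n) (p : IdxC n a k) : IsResonant a (p.weight hk) :=
  (csetPred_iff_isResonant (p.enum_injective hk) (p.range_enum hk) p.1.1).1 p.2.2

lemma IdxC.weightCoeff_weight (hk : k ≤ n) (P : W n k) (p : IdxC n a k) :
    weightCoeff P (p.weight hk) (p.enum hk)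
      = coeff (Finsupp.equivFunOnFinite.symm p.1.1) (P fun l => X (p.enum hk l)) := by
  rw [weightCoeff, IdxC.weight, sub_add_cancel, ← coeffInt_natCast]
  rfl

lemma finite_support_weightCoeff (hk : k ≤ n) (P : W n k) :
    (Function.support fun p : IdxC n a k => weightCoeff P (p.weight hk) (p.enum hk)).Finite := by
  have hinj : Function.Injective fun p : IdxC n a k =>
      ((Finsupp.equivFunOnFinite.symm p.1.1 : Fin n →₀ ℕ), p.1.2) := by
    intro p q h
    rw [Prod.mk.injEq] at h
    exact Subtype.ext (Prod.ext (Finsupp.equivFunOnFinite.symm.injective h.1) h.2)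
  refine ((((Set.finite_iUnion fun s : Fin k → Fin n =>
    (P fun l => X (s l)).support.finite_toSet).prod Set.finite_univ).preimage
      hinj.injOn).subset fun p hp => ?_)
  refine ⟨Set.mem_iUnion.2 ⟨p.enum hk, ?_⟩, Set.mem_univ _⟩
  rw [Function.mem_support, IdxC.weightCoeff_weight] at hp
  exact mem_support_iff.2 hp

/-- The resonant coefficients of a cocycle. -/
def resonantCoeff (a : Fin n → Fin n → ℤ) (hk : k ≤ n) : Zcoh n a k →ₗ[ℂ] (IdxC n a k →₀ ℂ) where
  toFun P := Finsupp.ofSupportFinite _ (finite_support_weightCoeff hk P.1)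
  map_add' P Q := by
    ext p
    simp [Finsupp.ofSupportFinite_coe, weightCoeff]
  map_smul' c P := by
    ext p
    simp [Finsupp.ofSupportFinite_coe, weightCoeff]

lemma resonantCoeff_apply (hk : k ≤ n) (P : Zcoh n a k) (p : IdxC n a k) :
    resonantCoeff a hk P p = weightCoeff P.1 (p.weight hk) (p.enum hk) := rfl

lemma ker_resonantCoeff (hn : 1 ≤ n) (ha : ∀ i j, a j i = - a i j) (hk : k ≤ n) :
    LinearMap.ker (resonantCoeff a hk) = (Bcoh n a k).comap (Zcoh n a k).subtype := by
  ext ⟨P, hP, hd⟩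
  rw [LinearMap.mem_ker, Submodule.mem_comap, Submodule.subtype_apply]
  constructor
  · intro h
    refine mem_Bcoh_of_weightCoeff_eq_zero hn ha hP hd fun w s hw => ?_
    by_cases hs : Function.Injective s
    · rcases exists_natCast_or_exists_neg (w + expSum s) with ⟨μ, hμ⟩ | ⟨i, hi⟩
      · let I : Finset (Fin n) := Finset.univ.image s
        have hI : I.card = k := by
          rw [Finset.card_image_of_injective _ hs, Finset.card_univ, Fintype.card_fin]
        have hr : Set.range s = ↑((Iᶜ)ᶜ) := by simp [I]
        have hw' : (fun i => (μ i : ℤ)) - expSum s = w := by rw [← hμ, add_sub_cancel_right]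
        let p : IdxC n a k := ⟨(μ, Iᶜ), by rw [Finset.card_compl, hI, Fintype.card_fin],
          (csetPred_iff_isResonant hs hr μ).2 (hw' ▸ hw)⟩
        obtain ⟨g, hg⟩ : ∃ g : Equiv.Perm (Fin k), s = p.enum hk ∘ g := by
          have hrange : Set.range s = Set.range (p.enum hk) := by rw [hr, p.range_enum hk]
          refine ⟨(Equiv.ofInjective s hs).trans ((Equiv.setCongr hrange).trans
            (Equiv.ofInjective _ (p.enum_injective hk)).symm), ?_⟩
          funext l
          simp [Equiv.apply_ofInjective_symm]
        have hpw : p.weight hk = w := by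
          rw [← hw', hg, expSum_comp_perm]
          rfl
        have h0 := resonantCoeff_apply hk ⟨P, hP, hd⟩ p
        rw [h, Finsupp.zero_apply, hpw] at h0
        rw [hg, weightCoeff_comp_perm hP]
        rw [← h0, mul_zero]
      · exact coeffInt_of_neg hi _
    · exact weightCoeff_eq_zero_of_not_injective hP w hs
  · intro h
    ext p
    rw [resonantCoeff_apply, Finsupp.zero_apply]
    cases k with
    | zero =>
      rw [Bcoh, Submodule.mem_bot] at h
      subst h
      simp [weightCoeff]
    | succ m =>
      obtain ⟨Q, hQ, rfl⟩ := h
      exact weightCoeff_dltL_of_isResonant ha hQ (p.isResonant_weight hk) (p.enum_injective hk)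

/-- The coefficients of the multivector field `X ^ α ∂_e`. -/
def basisCoeff (e : Fin k → Fin n) (α : Fin n →₀ ℕ) (s : Fin k → Fin n) : Rp n :=
  ∑ g : Equiv.Perm (Fin k), if s ∘ g = e then ((Equiv.Perm.sign g : ℤ) : ℂ) • monomial α 1 else 0

lemma basisCoeff_comp_perm (e : Fin k → Fin n) (α : Fin n →₀ ℕ) (s : Fin k → Fin n)
    (g : Equiv.Perm (Fin k)) :
    basisCoeff e α (s ∘ g) = ((Equiv.Perm.sign g : ℤ) : ℂ) • basisCoeff e α s := by
  rw [basisCoeff, basisCoeff, Finset.smul_sum]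
  refine Fintype.sum_equiv (Equiv.mulLeft g) _ _ fun h => ?_
  rw [smul_ite, smul_zero]
  refine if_congr Iff.rfl ?_ rfl
  rw [Equiv.coe_mulLeft, Equiv.Perm.sign_mul, smul_smul]
  congr 1
  rcases Int.units_eq_one_or (Equiv.Perm.sign g) with h1 | h1 <;> simp [h1]

lemma basisCoeff_self {e : Fin k → Fin n} (he : Function.Injective e) (α : Fin n →₀ ℕ) :
    basisCoeff e α e = monomial α 1 := by
  rw [basisCoeff, Finset.sum_eq_single 1]
  · simp
  · intro g _ hg
    rw [if_neg]
    intro h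
    exact hg (Equiv.ext fun l => he (congr_fun h l))
  · simp

lemma exists_comp_eq_of_basisCoeff_ne_zero {e : Fin k → Fin n} {α : Fin n →₀ ℕ}
    {s : Fin k → Fin n} {ν : Fin n → ℤ} (h : coeffInt ν (basisCoeff e α s) ≠ 0) :
    (∃ g : Equiv.Perm (Fin k), s ∘ g = e) ∧ ν = fun i => (α i : ℤ) := by
  rw [basisCoeff, map_sum] at h
  obtain ⟨g, _, hg⟩ := Finset.exists_ne_zero_of_sum_ne_zero h
  split_ifs at hg with hs
  · refine ⟨⟨g, hs⟩, ?_⟩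
    rcases exists_natCast_or_exists_neg ν with ⟨μ, rfl⟩ | ⟨i, hi⟩
    · rw [coeffInt_natCast, coeff_smul, coeff_monomial] at hg
      split_ifs at hg with hα
      · rw [hα]
      · simp at hg
    · exact absurd (coeffInt_of_neg hi _) hg
  · simp at hg

lemma resonantCoeff_surjective (ha : ∀ i j, a j i = - a i j) (hk : k ≤ n) :
    Function.Surjective (resonantCoeff a hk) := by
  rw [← LinearMap.range_eq_top, eq_top_iff, ← Finsupp.iSup_lsingle_range, iSup_le_iff]
  rintro p _ ⟨r, rfl⟩
  rw [Finsupp.lsingle_apply, ← mul_one r, ← smul_eq_mul, ← Finsupp.smul_single]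
  refine Submodule.smul_mem _ _ ?_
  let α : Fin n →₀ ℕ := Finsupp.equivFunOnFinite.symm p.1.1
  have hP : cochainOfCoeff (basisCoeff (p.enum hk) α) ∈ chiSub n k :=
    cochainOfCoeff_mem_chiSub (basisCoeff_comp_perm _ _)
  refine ⟨⟨cochainOfCoeff (basisCoeff (p.enum hk) α), hP,
    dltL_eq_zero_of_isResonant ha hP fun w s h => ?_⟩, ?_⟩
  · rw [weightCoeff, cochainOfCoeff_apply_X] at h
    obtain ⟨⟨g, hg⟩, hν⟩ := exists_comp_eq_of_basisCoeff_ne_zero h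
    have hw : w = p.weight hk := by
      rw [IdxC.weight, ← hg, expSum_comp_perm, eq_sub_iff_add_eq, hν]
      rfl
    exact hw ▸ p.isResonant_weight hk
  · ext q
    rw [resonantCoeff_apply, IdxC.weightCoeff_weight]
    change coeff _ (cochainOfCoeff _ _) = _
    rw [cochainOfCoeff_apply_X]
    by_cases hpq : p = q
    · subst hpq
      rw [basisCoeff_self (p.enum_injective hk), Finsupp.single_eq_same, coeff_monomial, if_pos rfl]
    · rw [Finsupp.single_eq_of_ne (Ne.symm hpq)]
      by_contra h
      rw [← coeffInt_natCast] at h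
      obtain ⟨⟨g, hg⟩, hν⟩ := exists_comp_eq_of_basisCoeff_ne_zero h
      refine hpq (Subtype.ext (Prod.ext (funext fun i => ?_) ?_))
      · exact_mod_cast (congr_fun hν i).symm
      · have hr : Set.range (p.enum hk) = Set.range (q.enum hk) := by
          rw [← hg, g.surjective.range_comp]
        rw [p.range_enum, q.range_enum, Finset.coe_inj] at hr
        exact compl_injective hr

end Idx

/-- Poisson cohomology of `R`, Monnier's theorem: for `0 ≤ k ≤ n`,
`HP^k(R)` is isomorphic as a ℂ-vector space to the abstract vector space with basis
indexed by the pairs `(α,β)` with `|β| = n−k` and `α+β ∈ C`, i.e. to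
`⊕_{|β|=n−k, α+β∈C} ℂ·X^α dX^β`. -/
theorem poisson_cohomology_of_quantum_affine_semiclassical_limit
    (n : ℕ) (hn : 1 ≤ n) (a : Fin n → Fin n → ℤ)
    (ha : ∀ i j, a j i = - a i j) (k : ℕ) (hk : k ≤ n) :
    Nonempty ((HPcoh n a k) ≃ₗ[ℂ] (IdxC n a k →₀ ℂ)) := by
  exact ⟨(Submodule.quotEquivOfEq _ _ (ker_resonantCoeff hn ha hk).symm).trans
    ((resonantCoeff a hk).quotKerEquivOfSurjective (resonantCoeff_surjective ha hk))⟩
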